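/- arXiv:1707.09893 — 3 statements merged into one kernel-verified Lean document; each statement's English description precedes it below -/
import Mathlib

section
/- Let N ≥ 1 and consider the complex Euclidean space H = ℂ^{Bool × (Fin N → Bool)} (the state space of one result qubit and N data qubits). For y : Fin N → Bool, u ∈ {0,1}, and m ∈ Fin N, define the vector ψ(y, u, m) ∈ H by: ψ(y,u,m)(false, z) = 1/√2 if z = y and 0 otherwise; ψ(y,u,m)(true, z) = (−1)^u/√2 if z = flip_m(y) and 0 otherwise, where flip_m(y) is the function equal to y except that its value at coordinate m is negated. Then for each fixed m ∈ Fin N, the family {ψ(y, u, m) : y ∈ (Fin N → Bool), u ∈ {0,1}} of 2^{N+1} vectors is an orthonormal basis of H. -/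
theorem Function.injective_update_bool_not {ι : Type*} [DecidableEq ι] (m : ι) :
    Function.Injective (fun y : ι → Bool => Function.update y m (!(y m))) :=
  Function.Involutive.injective fun y => by simp

/-- The key fact behind Lemma 2 (thm:TestStateDis): for each fixed swap position `m`, the
test states `|ψ(y,u,m)⟩` (the result qubit entangled with the `m`-th data qubit, with
relative phase `(-1)^u`) form an orthonormal basis of the state space
`ℂ^(Bool × (Fin N → Bool))` of one result qubit and `N` data qubits. -/
theorem stmt6 (N : ℕ) (hN : 1 ≤ N)
    (ψ : (Fin N → Bool) → Bool → Fin N → EuclideanSpace ℂ (Bool × (Fin N → Bool)))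
    (hψ : ∀ (y : Fin N → Bool) (u : Bool) (m : Fin N) (b : Bool) (z : Fin N → Bool),
      ψ y u m (b, z) =
        if b then
          (if z = Function.update y m (!(y m)) then
            (if u then (-1 : ℂ) else 1) / (Real.sqrt 2 : ℂ) else 0)
        else (if z = y then 1 / (Real.sqrt 2 : ℂ) else 0))
    (m : Fin N) :
    Orthonormal ℂ (fun yu : (Fin N → Bool) × Bool => ψ yu.1 yu.2 m) ∧
    Submodule.span ℂ (Set.range (fun yu : (Fin N → Bool) × Bool => ψ yu.1 yu.2 m)) = ⊤ := by
  have h_orth : Orthonormal ℂ (fun yu : (Fin N → Bool) × Bool => ψ yu.1 yu.2 m) := by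
    rw [orthonormal_iff_ite]
    rintro ⟨y, u⟩ ⟨y', u'⟩
    have h_sqrt : ((Real.sqrt 2 : ℝ) : ℂ)⁻¹ * ((Real.sqrt 2 : ℝ) : ℂ)⁻¹ = 1 / 2 := by
      rw [← mul_inv, ← Complex.ofReal_mul, Real.mul_self_sqrt zero_le_two]
      norm_num
    simp only [PiLp.inner_apply, RCLike.inner_apply, Fintype.sum_prod_type, Fintype.sum_bool, hψ]
    by_cases h : y = y'
    · subst h
      cases u <;> cases u' <;> simp [h_sqrt, neg_div] <;> norm_num
    · have h_flip := (Function.injective_update_bool_not m).ne h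
      simp [h, Ne.symm h, Ne.symm h_flip]
  refine ⟨h_orth, h_orth.linearIndependent.span_eq_top_of_card_eq_finrank' ?_⟩
  rw [finrank_euclideanSpace, Fintype.card_prod, Fintype.card_prod, mul_comm]
end

section
/- Let d ≥ 1 and K ≥ 1, and let H = ℂ^d be the complex Euclidean space with its standard Hermitian inner product. For each m ∈ Fin K, let B_m : Fin d → H be an orthonormal basis of H. Let M : H → H be a nonzero linear map. Then for every m ∈ Fin K and every j ∈ Fin d, ‖M (B_m j)‖² / (Σ_{m' ∈ Fin K} Σ_{j' ∈ Fin d} ‖M (B_{m'} j')‖²) ≤ 1/K. (In particular, the denominator is strictly positive.) -/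
namespace OrthonormalBasis

variable {𝕜 ι κ E F : Type*} [RCLike 𝕜] [Fintype ι] [Fintype κ]
  [NormedAddCommGroup E] [InnerProductSpace 𝕜 E]
  [NormedAddCommGroup F] [InnerProductSpace 𝕜 F]

theorem sum_sq_norm_map_pos (b : OrthonormalBasis ι 𝕜 E) {M : E →ₗ[𝕜] F} (hM : M ≠ 0) :
    0 < ∑ j, ‖M (b j)‖ ^ 2 := by
  obtain ⟨i, hi⟩ : ∃ i, M (b i) ≠ 0 := by
    by_contra! h
    exact hM (b.toBasis.ext fun i => by simpa using h i)
  exact Finset.sum_pos' (fun _ _ => by positivity) ⟨i, Finset.mem_univ i, by positivity⟩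

variable [FiniteDimensional 𝕜 E] [FiniteDimensional 𝕜 F]

theorem sum_sq_norm_map_eq_sum_sq_norm_adjoint (b : OrthonormalBasis ι 𝕜 E)
    (c : OrthonormalBasis κ 𝕜 F) (M : E →ₗ[𝕜] F) :
    ∑ j, ‖M (b j)‖ ^ 2 = ∑ i, ‖M.adjoint (c i)‖ ^ 2 := by
  simp_rw [← c.sum_sq_norm_inner_right (M _), ← b.sum_sq_norm_inner_left (M.adjoint _),
    LinearMap.adjoint_inner_left]
  exact Finset.sum_comm

/-- The Hilbert–Schmidt norm of a linear map does not depend on the orthonormal basis. -/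
theorem sum_sq_norm_map_eq (b : OrthonormalBasis ι 𝕜 E) (c : OrthonormalBasis κ 𝕜 E)
    (M : E →ₗ[𝕜] F) : ∑ j, ‖M (b j)‖ ^ 2 = ∑ i, ‖M (c i)‖ ^ 2 :=
  (b.sum_sq_norm_map_eq_sum_sq_norm_adjoint (stdOrthonormalBasis 𝕜 F) M).trans
    (c.sum_sq_norm_map_eq_sum_sq_norm_adjoint _ M).symm

end OrthonormalBasis

/-- Lemma 2 (thm:TestStateDis): if for each `m ∈ Fin K` the family `B m` is an orthonormal
basis of `ℂ^d` and `M` is a nonzero linear map (a measurement/Kraus operator), then the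
Bayesian posterior probability of any particular state `B m j` given the outcome `M`,
namely `‖M (B m j)‖² / ∑_{m',j'} ‖M (B m' j')‖²`, is at most `1/K`; in particular the
normalizing denominator is strictly positive. -/
theorem stmt7 (d K : ℕ) (hd : 1 ≤ d) (hK : 1 ≤ K)
    (B : Fin K → OrthonormalBasis (Fin d) ℂ (EuclideanSpace ℂ (Fin d)))
    (M : EuclideanSpace ℂ (Fin d) →ₗ[ℂ] EuclideanSpace ℂ (Fin d)) (hM : M ≠ 0)
    (m : Fin K) (j : Fin d) :
    0 < ∑ m' : Fin K, ∑ j' : Fin d, ‖M (B m' j')‖ ^ 2 ∧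
    ‖M (B m j)‖ ^ 2 / (∑ m' : Fin K, ∑ j' : Fin d, ‖M (B m' j')‖ ^ 2) ≤ 1 / (K : ℝ) := by
  have hsum : ∑ m' : Fin K, ∑ j' : Fin d, ‖M (B m' j')‖ ^ 2 = K * ∑ j', ‖M (B m j')‖ ^ 2 := by
    simp [fun m' => (B m').sum_sq_norm_map_eq (B m) M]
  have hpos : 0 < ∑ j', ‖M (B m j')‖ ^ 2 := (B m).sum_sq_norm_map_pos hM
  have hK' : (0 : ℝ) < K := by exact_mod_cast hK
  have hle : ‖M (B m j)‖ ^ 2 ≤ ∑ j', ‖M (B m j')‖ ^ 2 :=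
    Finset.single_le_sum (f := fun j' => ‖M (B m j')‖ ^ 2) (fun _ _ => by positivity)
      (Finset.mem_univ j)
  rw [hsum]
  refine ⟨by positivity, ?_⟩
  rw [div_le_div_iff₀ (by positivity) hK', one_mul, mul_comm]
  gcongr
end

section
/- Let d₁, d₂ ≥ 1. Represent a bipartite pure state of systems of dimensions d₁ and d₂ as a matrix φ ∈ Matrix (Fin d₁) (Fin d₂) ℂ, with Frobenius norm ‖φ‖ = 1 (φ_{ij} is the coefficient of the basis state |i⟩|j⟩, and simple tensors a ⊗ ξ correspond to the outer product vecMulVec a ξ with entries a_i ξ_j). Let W ∈ Matrix (Fin d₁) (Fin d₁) ℂ be unitary, let u, v ∈ ℂ^{d₁} be orthonormal vectors, and let ξ₀, ξ₁ ∈ ℂ^{d₂}. Suppose W * φ = vecMulVec u ξ₀ + vecMulVec v ξ₁, and that ‖ξ₀‖ = 1 or ‖ξ₁‖ = 1. Then either φ = Wᴴ * vecMulVec u ξ₀ or φ = Wᴴ * vecMulVec v ξ₁; in particular, φ is a simple tensor (a rank-one outer product), i.e., the first system is separable from the second. -/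
open scoped Matrix

theorem star_dotProduct_self_eq_sum_norm_sq {ι : Type*} [Fintype ι] (x : ι → ℂ) :
    star x ⬝ᵥ x = ((∑ i, ‖x i‖ ^ 2 : ℝ) : ℂ) := by
  simp [dotProduct, Complex.conj_mul']

theorem trace_conjTranspose_mul_self_eq_sum_norm_sq {m n : Type*} [Fintype m] [Fintype n]
    (A : Matrix m n ℂ) : (Aᴴ * A).trace = ((∑ i, ∑ j, ‖A i j‖ ^ 2 : ℝ) : ℂ) := by
  rw [Finset.sum_comm]
  simp [Matrix.trace, Matrix.mul_apply, Complex.conj_mul']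

theorem trace_conjTranspose_mul_self_vecMulVec_add {m n : Type*} [Fintype m] [Fintype n]
    {u v : m → ℂ} (hu : star u ⬝ᵥ u = 1) (hv : star v ⬝ᵥ v = 1) (huv : star u ⬝ᵥ v = 0)
    (a b : n → ℂ) :
    ((Matrix.vecMulVec u a + Matrix.vecMulVec v b)ᴴ *
      (Matrix.vecMulVec u a + Matrix.vecMulVec v b)).trace = star a ⬝ᵥ a + star b ⬝ᵥ b := by
  have hvu : star v ⬝ᵥ u = 0 := by
    rw [Matrix.star_dotProduct, huv, star_zero]
  simp [Matrix.conjTranspose_vecMulVec, Matrix.add_mul, Matrix.mul_add,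
    Matrix.vecMulVec_mul_vecMulVec, hu, hv, huv, hvu, Matrix.trace_vecMulVec]

theorem eq_zero_of_sum_norm_sq_eq_zero {ι : Type*} [Fintype ι] {x : ι → ℂ}
    (h : ∑ i, ‖x i‖ ^ 2 = 0) : x = 0 := by
  rw [Finset.sum_eq_zero_iff_of_nonneg fun i _ => by positivity] at h
  ext i
  simpa using h i

theorem vecMulVec_zero_right {m n : Type*} (u : m → ℂ) :
    Matrix.vecMulVec u (0 : n → ℂ) = 0 := by
  ext i j
  simp [Matrix.vecMulVec_apply]

/-- Lemma 1 (lem:State): represent a bipartite pure state as a matrix `φ` with unit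
Frobenius norm. If after a unitary `W` (acting on the first system) the state is
`u ⊗ ξ₀ + v ⊗ ξ₁` with `u, v` orthonormal and `‖ξ₀‖ = 1` or `‖ξ₁‖ = 1`, then
`φ = Wᴴ * (u ⊗ ξ₀)` or `φ = Wᴴ * (v ⊗ ξ₁)`; in particular `φ` is a simple tensor, i.e.
the first system is separable from the second. -/
theorem stmt8 (d₁ d₂ : ℕ) (hd₁ : 1 ≤ d₁) (hd₂ : 1 ≤ d₂)
    (φ : Matrix (Fin d₁) (Fin d₂) ℂ)
    (hφnorm : ∑ i : Fin d₁, ∑ j : Fin d₂, ‖φ i j‖ ^ 2 = 1)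
    (W : Matrix (Fin d₁) (Fin d₁) ℂ) (hW : W ∈ Matrix.unitaryGroup (Fin d₁) ℂ)
    (u v : Fin d₁ → ℂ)
    (hu : ∑ i : Fin d₁, ‖u i‖ ^ 2 = 1) (hv : ∑ i : Fin d₁, ‖v i‖ ^ 2 = 1)
    (huv : ∑ i : Fin d₁, star (u i) * v i = 0)
    (ξ₀ ξ₁ : Fin d₂ → ℂ)
    (hWφ : W * φ = Matrix.vecMulVec u ξ₀ + Matrix.vecMulVec v ξ₁)
    (hξ : ∑ j : Fin d₂, ‖ξ₀ j‖ ^ 2 = 1 ∨ ∑ j : Fin d₂, ‖ξ₁ j‖ ^ 2 = 1) :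
    (φ = Wᴴ * Matrix.vecMulVec u ξ₀ ∨ φ = Wᴴ * Matrix.vecMulVec v ξ₁) ∧
    ∃ (a : Fin d₁ → ℂ) (ξ : Fin d₂ → ℂ), φ = Matrix.vecMulVec a ξ := by
  have hWW : Wᴴ * W = 1 := Matrix.mem_unitaryGroup_iff'.mp hW
  have hφ : φ = Wᴴ * (Matrix.vecMulVec u ξ₀ + Matrix.vecMulVec v ξ₁) := by
    rw [← hWφ, ← Matrix.mul_assoc, hWW, Matrix.one_mul]
  have hsum : ∑ j, ‖ξ₀ j‖ ^ 2 + ∑ j, ‖ξ₁ j‖ ^ 2 = 1 := by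
    have hu' : star u ⬝ᵥ u = 1 := by
      rw [star_dotProduct_self_eq_sum_norm_sq, hu, Complex.ofReal_one]
    have hv' : star v ⬝ᵥ v = 1 := by
      rw [star_dotProduct_self_eq_sum_norm_sq, hv, Complex.ofReal_one]
    have h := trace_conjTranspose_mul_self_vecMulVec_add hu' hv' huv ξ₀ ξ₁
    rw [← hWφ, Matrix.conjTranspose_mul, Matrix.mul_assoc, ← Matrix.mul_assoc Wᴴ, hWW,
      Matrix.one_mul, trace_conjTranspose_mul_self_eq_sum_norm_sq, hφnorm,
      star_dotProduct_self_eq_sum_norm_sq, star_dotProduct_self_eq_sum_norm_sq] at h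
    exact_mod_cast h.symm
  rcases hξ with h | h
  · have hξ₁ : ξ₁ = 0 := eq_zero_of_sum_norm_sq_eq_zero (by linarith)
    have hφu : φ = Wᴴ * Matrix.vecMulVec u ξ₀ := by simpa [hξ₁, vecMulVec_zero_right] using hφ
    exact ⟨.inl hφu, Wᴴ *ᵥ u, ξ₀, by rw [hφu, Matrix.mul_vecMulVec]⟩
  · have hξ₀ : ξ₀ = 0 := eq_zero_of_sum_norm_sq_eq_zero (by linarith)
    have hφv : φ = Wᴴ * Matrix.vecMulVec v ξ₁ := by simpa [hξ₀, vecMulVec_zero_right] using hφ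
    exact ⟨.inr hφv, Wᴴ *ᵥ v, ξ₁, by rw [hφv, Matrix.mul_vecMulVec]⟩
end
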